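/- arXiv:1210.2412 — 5 statements merged into one kernel-verified Lean document; each statement's English description precedes it below -/
import Mathlib

section
/- Let (P,ω) be a labeled poset with |P| = n. Then for every weight α, the number of (P,ω)-partitions of weight α equals the sum, over all linear extensions π ∈ L(P,ω), of the number of weakly increasing sequences i₁ ≤ i₂ ≤ ⋯ ≤ i_n of positive integers such that i_j < i_{j+1} whenever j ∈ Des(π) and such that #{ j : i_j = m } = α(m) for every positive integer m. (Equivalently, K_{(P,ω)} = Σ_{π ∈ L(P,ω)} F_{Des(π),n}, the expansion of the (P,ω)-partition generating function into fundamental quasisymmetric functions.) -/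
/-- A labeling of a finite poset: a bijection onto `{1, …, n}`. -/
def IsLabeling {α : Type*} (ω : α → ℕ) : Prop :=
  Set.BijOn ω Set.univ (Set.Icc 1 (Nat.card α))

/-- `f` is a `(P,ω)`-partition. -/
def IsPtn {α : Type*} [PartialOrder α] (ω : α → ℕ) (f : α → ℕ) : Prop :=
  (∀ a, 1 ≤ f a) ∧ (∀ a b : α, a ≤ b → f a ≤ f b) ∧
    (∀ a b : α, a ≤ b → ω b < ω a → f a < f b)

/-- The number of `(P,ω)`-partitions of weight `w`. -/
noncomputable def ptnCount {α : Type*} [PartialOrder α] (ω : α → ℕ) (w : ℕ →₀ ℕ) : ℕ :=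
  Set.ncard {f : α → ℕ | IsPtn ω f ∧ ∀ m : ℕ, 1 ≤ m → (f ⁻¹' {m}).ncard = w m}

/-- `π` (a word recorded on positions `1,…,n`, padded by `0` elsewhere) is a linear
extension of the labeled poset `(P,ω)`. -/
def IsLinExtWord {α : Type*} [PartialOrder α] [Fintype α] (ω : α → ℕ) (π : ℕ → ℕ) : Prop :=
  (∃ e : Fin (Fintype.card α) ≃ α, (∀ i j, e i < e j → i < j) ∧
    ∀ i : Fin (Fintype.card α), π ((i : ℕ) + 1) = ω (e i)) ∧
  ∀ j : ℕ, (j = 0 ∨ Fintype.card α < j) → π j = 0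

/-- The number of weakly increasing sequences `i₁ ≤ i₂ ≤ ⋯ ≤ i_n` of positive integers
(recorded as `g 1, …, g n` with `g` padded by `0` elsewhere) with `i_j < i_{j+1}` whenever
`j` is a descent of the word `π`, and with exactly `w m` entries equal to `m` for each
positive integer `m`.  This is the coefficient interpretation of the fundamental
quasisymmetric function `F_{Des(π), n}`. -/
noncomputable def fundCount (n : ℕ) (π : ℕ → ℕ) (w : ℕ →₀ ℕ) : ℕ :=
  Set.ncard {g : ℕ → ℕ |
    (∀ j : ℕ, 1 ≤ j → j ≤ n → 1 ≤ g j) ∧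
    (∀ j : ℕ, 1 ≤ j → j + 1 ≤ n → g j ≤ g (j + 1)) ∧
    (∀ j : ℕ, 1 ≤ j → j + 1 ≤ n → π (j + 1) < π j → g j < g (j + 1)) ∧
    (∀ j : ℕ, (j = 0 ∨ n < j) → g j = 0) ∧
    ∀ m : ℕ, 1 ≤ m → (g ⁻¹' {m}).ncard = w m}

theorem strictMono_fin_of_lt_succ {β : Type*} [Preorder β] {n : ℕ} {k : ℕ → β}
    (h : ∀ j, 1 ≤ j → j + 1 ≤ n → k j < k (j + 1)) :
    StrictMono fun i : Fin n => k ((i : ℕ) + 1) := by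
  intro i j hij
  have hk : StrictMonoOn k (Set.Icc 1 n) :=
    strictMonoOn_of_lt_succ Set.ordConnected_Icc fun a _ ha hb => h a ha.1 hb.2
  have := i.2
  have := j.2
  have : (i : ℕ) < j := hij
  exact hk ⟨by omega, by omega⟩ ⟨by omega, by omega⟩ (by omega)

/-- The elements of a finite type can be listed in strictly increasing order of an
injective key. -/
theorem exists_equiv_strictMono {α β : Type*} [Fintype α] [LinearOrder β] {k : α → β}
    (hk : Function.Injective k) :
    ∃ e : Fin (Fintype.card α) ≃ α, StrictMono fun i => k (e i) := by
  let e₀ := (Fintype.equivFin α).symm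
  refine ⟨(Tuple.sort (k ∘ e₀)).trans e₀, ?_⟩
  exact (Tuple.monotone_sort (k ∘ e₀)).strictMono_of_injective
    (hk.comp (e₀.injective.comp (Equiv.injective _)))

theorem equiv_eq_of_strictMono {α β : Type*} {n : ℕ} [LinearOrder β] {k : α → β}
    {e e' : Fin n ≃ α} (hk : Function.Injective k) (h : StrictMono fun i => k (e i))
    (h' : StrictMono fun i => k (e' i)) : e = e' := by
  have hr : Set.range (fun i => k (e i)) = Set.range fun i => k (e' i) := by
    change Set.range (k ∘ e) = Set.range (k ∘ e')
    rw [e.surjective.range_comp, e'.surjective.range_comp]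
  have := (h.range_inj h').1 hr
  ext i
  exact hk (congrFun this i)

section
variable {α : Type*}

/-- The key by which a `(P,ω)`-partition sorts the elements of `P`. -/
def ptnKey (ω f : α → ℕ) (a : α) : ℕ ×ₗ ℕ := toLex (f a, ω a)

theorem ptnKey_lt {ω f : α → ℕ} {a b : α} :
    ptnKey ω f a < ptnKey ω f b ↔ f a < f b ∨ f a = f b ∧ ω a < ω b := by
  simp [ptnKey, Prod.Lex.toLex_lt_toLex]

theorem ptnKey_injective {ω : α → ℕ} (hω : Function.Injective ω) (f : α → ℕ) :
    Function.Injective (ptnKey ω f) := by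
  intro a b h
  simp only [ptnKey, EmbeddingLike.apply_eq_iff_eq, Prod.mk.injEq] at h
  exact hω h.2

/-- The `(P,ω)`-partitions of weight `w`. -/
def ptnSet [PartialOrder α] (ω : α → ℕ) (w : ℕ →₀ ℕ) : Set (α → ℕ) :=
  {f : α → ℕ | IsPtn ω f ∧ ∀ m : ℕ, 1 ≤ m → (f ⁻¹' {m}).ncard = w m}

/-- The sequences counted by `fundCount`. -/
def fundSet (n : ℕ) (π : ℕ → ℕ) (w : ℕ →₀ ℕ) : Set (ℕ → ℕ) :=
  {g : ℕ → ℕ |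
    (∀ j : ℕ, 1 ≤ j → j ≤ n → 1 ≤ g j) ∧
    (∀ j : ℕ, 1 ≤ j → j + 1 ≤ n → g j ≤ g (j + 1)) ∧
    (∀ j : ℕ, 1 ≤ j → j + 1 ≤ n → π (j + 1) < π j → g j < g (j + 1)) ∧
    (∀ j : ℕ, (j = 0 ∨ n < j) → g j = 0) ∧
    ∀ m : ℕ, 1 ≤ m → (g ⁻¹' {m}).ncard = w m}

theorem finite_ptnSet [PartialOrder α] [Finite α] (ω : α → ℕ) (w : ℕ →₀ ℕ) :
    (ptnSet ω w).Finite := by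
  refine (Set.Finite.pi fun _ : α => w.support.finite_toSet).subset ?_
  rintro f ⟨hf, hw⟩ a -
  rw [Finset.mem_coe, Finsupp.mem_support_iff, ← hw _ (hf.1 a)]
  exact ((Set.ncard_pos (s := f ⁻¹' {f a}) (Set.toFinite _)).2 ⟨a, rfl⟩).ne'

/-- The word on positions `1, …, n`, padded by `0`, with the values of `f` along `e`. -/
def padWord {n : ℕ} (e : Fin n ≃ α) (f : α → ℕ) (j : ℕ) : ℕ :=
  if h : 1 ≤ j ∧ j ≤ n then f (e ⟨j - 1, by omega⟩) else 0

theorem padWord_succ {n : ℕ} (e : Fin n ≃ α) (f : α → ℕ) (i : Fin n) :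
    padWord e f ((i : ℕ) + 1) = f (e i) := by
  have := i.2
  simp [padWord, show (i : ℕ) + 1 ≤ n by omega]

theorem padWord_eq_zero {n : ℕ} (e : Fin n ≃ α) (f : α → ℕ) (j : ℕ) (h : j = 0 ∨ n < j) :
    padWord e f j = 0 :=
  dif_neg (by omega)

theorem eq_padWord {n : ℕ} {e : Fin n ≃ α} {f : α → ℕ} {g : ℕ → ℕ}
    (h : ∀ i : Fin n, g ((i : ℕ) + 1) = f (e i)) (h0 : ∀ j : ℕ, (j = 0 ∨ n < j) → g j = 0) :
    g = padWord e f := by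
  ext j
  by_cases hj : 1 ≤ j ∧ j ≤ n
  · obtain ⟨i, rfl⟩ : ∃ i : Fin n, j = (i : ℕ) + 1 := ⟨⟨j - 1, by omega⟩, by simp; omega⟩
    rw [h, padWord_succ]
  · rw [h0 j (by omega), padWord_eq_zero e f j (by omega)]

theorem ncard_padWord_preimage {n : ℕ} (e : Fin n ≃ α) (f : α → ℕ) {m : ℕ} (hm : 1 ≤ m) :
    (padWord e f ⁻¹' {m}).ncard = (f ⁻¹' {m}).ncard := by
  have hinj : Function.Injective fun a => (e.symm a : ℕ) + 1 := fun a b h =>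
    e.symm.injective (Fin.ext (Nat.succ_injective h))
  rw [← Set.ncard_image_of_injective _ hinj]
  congr 1
  ext j
  simp only [Set.mem_preimage, Set.mem_singleton_iff, Set.mem_image]
  constructor
  · intro h
    have hj : 1 ≤ j ∧ j ≤ n := by
      by_contra hj
      rw [padWord_eq_zero e f j (by omega)] at h
      omega
    obtain ⟨i, rfl⟩ : ∃ i : Fin n, j = (i : ℕ) + 1 := ⟨⟨j - 1, by omega⟩, by simp; omega⟩
    rw [padWord_succ] at h
    exact ⟨e i, h, by simp⟩
  · rintro ⟨a, ha, rfl⟩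
    rw [padWord_succ, e.apply_symm_apply, ha]

theorem isLinExtWord_iff [PartialOrder α] [Fintype α] {ω : α → ℕ} {π : ℕ → ℕ} :
    IsLinExtWord ω π ↔ ∃ e : Fin (Fintype.card α) ≃ α,
      (∀ i j, e i < e j → i < j) ∧ π = padWord e ω := by
  constructor
  · rintro ⟨⟨e, he, hπ⟩, h0⟩
    exact ⟨e, he, eq_padWord hπ h0⟩
  · rintro ⟨e, he, rfl⟩
    exact ⟨⟨e, he, padWord_succ e ω⟩, padWord_eq_zero e ω⟩

theorem strictMono_of_padWord_mem_fundSet {ω : α → ℕ} (hω : Function.Injective ω) {n : ℕ}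
    {e : Fin n ≃ α} {f : α → ℕ} {w : ℕ →₀ ℕ}
    (h : padWord e f ∈ fundSet n (padWord e ω) w) :
    StrictMono fun i => ptnKey ω f (e i) := by
  obtain ⟨-, hle, hlt, -, -⟩ := h
  have := strictMono_fin_of_lt_succ (n := n)
    (k := fun j => (toLex (padWord e f j, padWord e ω j) : ℕ ×ₗ ℕ)) ?_
  · simpa only [padWord_succ, ptnKey] using this
  intro j hj hjn
  have hne : padWord e ω j ≠ padWord e ω (j + 1) := by
    obtain ⟨i, rfl⟩ : ∃ i, j = i + 1 := ⟨j - 1, by omega⟩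
    have h₁ := padWord_succ e ω ⟨i, by omega⟩
    have h₂ := padWord_succ e ω ⟨i + 1, by omega⟩
    simp only at h₁ h₂
    rw [h₁, h₂, hω.ne_iff, e.injective.ne_iff]
    simp
  have := hle j hj hjn
  have := hlt j hj hjn
  rw [Prod.Lex.toLex_lt_toLex]
  simp only
  omega

theorem padWord_mem_fundSet {ω : α → ℕ} {n : ℕ} {e : Fin n ≃ α} {f : α → ℕ} {w : ℕ →₀ ℕ}
    (hpos : ∀ a, 1 ≤ f a) (hw : ∀ m : ℕ, 1 ≤ m → (f ⁻¹' {m}).ncard = w m)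
    (he : StrictMono fun i => ptnKey ω f (e i)) :
    padWord e f ∈ fundSet n (padWord e ω) w := by
  have key : ∀ j, 1 ≤ j → j + 1 ≤ n → padWord e f j < padWord e f (j + 1) ∨
      padWord e f j = padWord e f (j + 1) ∧ padWord e ω j < padWord e ω (j + 1) := by
    intro j hj hjn
    obtain ⟨i, rfl⟩ : ∃ i, j = i + 1 := ⟨j - 1, by omega⟩
    have h := ptnKey_lt.1 (he (show (⟨i, by omega⟩ : Fin n) < ⟨i + 1, by omega⟩ by simp))
    simpa only [← padWord_succ] using h
  refine ⟨fun j hj hjn => ?_, fun j hj hjn => ?_, fun j hj hjn hd => ?_,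
    padWord_eq_zero e f, fun m hm => (ncard_padWord_preimage e f hm).trans (hw m hm)⟩
  · rw [padWord, dif_pos ⟨hj, hjn⟩]
    exact hpos _
  · have := key j hj hjn
    omega
  · have := key j hj hjn
    omega

variable [PartialOrder α]

theorem lt_of_strictMono_ptnKey {ω f : α → ℕ} (hω : Function.Injective ω) {n : ℕ}
    {e : Fin n ≃ α} (hf : IsPtn ω f) (he : StrictMono fun i => ptnKey ω f (e i))
    (i j : Fin n) (hij : e i < e j) : i < j := by
  refine he.lt_iff_lt.1 (ptnKey_lt.2 ?_)
  have h₁ := hf.2.1 _ _ hij.le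
  have h₂ := hf.2.2 _ _ hij.le
  have h₃ := hω.ne hij.ne
  omega

theorem mem_ptnSet_of_strictMono {ω f : α → ℕ} {n : ℕ} {e : Fin n ≃ α} {w : ℕ →₀ ℕ}
    (hlin : ∀ i j, e i < e j → i < j) (he : StrictMono fun i => ptnKey ω f (e i))
    (hg : padWord e f ∈ fundSet n (padWord e ω) w) : f ∈ ptnSet ω w := by
  have key : ∀ a b, a < b → f a < f b ∨ f a = f b ∧ ω a < ω b := by
    intro a b hab
    have := he (hlin (e.symm a) (e.symm b) (by simpa using hab))
    simpa using ptnKey_lt.1 this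
  refine ⟨⟨fun a => ?_, fun a b hab => ?_, fun a b hab hd => ?_⟩, fun m hm => ?_⟩
  · have := hg.1 ((e.symm a : ℕ) + 1) (by omega) (e.symm a).2
    rwa [padWord_succ, e.apply_symm_apply] at this
  · rcases hab.eq_or_lt with rfl | hab
    · rfl
    · have := key a b hab
      omega
  · rcases hab.eq_or_lt with rfl | hab
    · omega
    · have := key a b hab
      omega
  · rw [← ncard_padWord_preimage e f hm]
    exact hg.2.2.2.2 m hm

/-- Sorting by `(f a, ω a)` matches `(P,ω)`-partitions with pairs of a linear extension
and a compatible sequence. -/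
theorem exists_bijective_sigma [Fintype α] {ω : α → ℕ} (hω : Function.Injective ω)
    (w : ℕ →₀ ℕ) :
    ∃ F : ptnSet ω w →
        Σ π : {π : ℕ → ℕ // IsLinExtWord ω π}, fundSet (Fintype.card α) (π : ℕ → ℕ) w,
      Function.Bijective F := by
  choose e he using fun f : ptnSet ω w =>
    exists_equiv_strictMono (ptnKey_injective hω (f : α → ℕ))
  refine ⟨fun f => ⟨⟨padWord (e f) ω, isLinExtWord_iff.2
      ⟨e f, lt_of_strictMono_ptnKey hω f.2.1 (he f), rfl⟩⟩,
    ⟨padWord (e f) f, padWord_mem_fundSet f.2.1.1 f.2.2 (he f)⟩⟩, ?_, ?_⟩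
  · intro f f' h
    have hπ := congrArg (fun x => (x.1 : ℕ → ℕ)) h
    have hg := congrArg (fun x => (x.2 : ℕ → ℕ)) h
    simp only at hπ hg
    have hee : e f = e f' := by
      ext i
      apply hω
      rw [← padWord_succ (e f) ω, ← padWord_succ (e f') ω, hπ]
    ext a
    obtain ⟨i, rfl⟩ := (e f).surjective a
    rw [← padWord_succ (e f) f, hg, hee, padWord_succ]
  · rintro ⟨⟨π, hπ⟩, ⟨g, hg⟩⟩
    obtain ⟨e', hlin, rfl⟩ := isLinExtWord_iff.1 hπ
    obtain ⟨f, rfl⟩ : ∃ f : α → ℕ, g = padWord e' f :=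
      ⟨fun a => g ((e'.symm a : ℕ) + 1), eq_padWord (by simp) hg.2.2.2.1⟩
    have hmono := strictMono_of_padWord_mem_fundSet hω hg
    have hf := mem_ptnSet_of_strictMono hlin hmono hg
    have hee := equiv_eq_of_strictMono (ptnKey_injective hω f) (he ⟨f, hf⟩) hmono
    subst hee
    exact ⟨⟨f, hf⟩, rfl⟩

theorem finite_isLinExtWord [Fintype α] (ω : α → ℕ) :
    Finite {π : ℕ → ℕ // IsLinExtWord ω π} := by
  choose e _ he using fun π : {π : ℕ → ℕ // IsLinExtWord ω π} => isLinExtWord_iff.1 π.2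
  refine Finite.of_injective e fun π π' h => Subtype.ext ?_
  rw [he π, he π', h]

end

/-- Theorem (Stanley; Gessel).  For a labeled poset `(P,ω)` with `|P| = n` and any weight `w`,
the number of `(P,ω)`-partitions of weight `w` is the sum, over all linear extensions `π`
of `(P,ω)`, of the number of weakly increasing sequences of positive integers of content `w`
that are strict at the descents of `π`; i.e.
`K_{(P,ω)} = ∑_{π ∈ L(P,ω)} F_{Des(π), n}`. -/
theorem stmt0 {α : Type*} [PartialOrder α] [Fintype α] (ω : α → ℕ)
    (hω : IsLabeling ω) (w : ℕ →₀ ℕ) :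
    ptnCount ω w =
      ∑' π : {π : ℕ → ℕ // IsLinExtWord ω π}, fundCount (Fintype.card α) (π : ℕ → ℕ) w := by
  have hinj : Function.Injective ω := Set.injOn_univ.1 hω.injOn
  obtain ⟨F, hF⟩ := exists_bijective_sigma hinj w
  have := finite_isLinExtWord ω
  have := Fintype.ofFinite {π : ℕ → ℕ // IsLinExtWord ω π}
  have := (finite_ptnSet ω w).to_subtype
  have := Finite.of_surjective F hF.2
  have (π : {π : ℕ → ℕ // IsLinExtWord ω π}) :
      Finite (fundSet (Fintype.card α) (π : ℕ → ℕ) w) :=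
    Finite.of_injective _ (sigma_mk_injective (i := π)
      (β := fun π : {π : ℕ → ℕ // IsLinExtWord ω π} =>
        fundSet (Fintype.card α) (π : ℕ → ℕ) w))
  rw [tsum_fintype]
  exact (Nat.card_congr (Equiv.ofBijective F hF)).trans Nat.card_sigma
end

section
/- Suppose (P,ω) is a naturally labeled poset and (P,ω) ~ (Q,τ) for some labeled poset (Q,τ). Then (Q,τ) is also naturally labeled. -/
/-- `(P,ω) ~ (Q,τ)`: equality of the `(P,ω)`-partition generating functions. -/
def KEq {α β : Type*} [PartialOrder α] [PartialOrder β] (ω : α → ℕ) (τ : β → ℕ) : Prop :=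
  ∀ w : ℕ →₀ ℕ, ptnCount ω w = ptnCount τ w

/-- `(P,ω)` is naturally labeled: `a ≤ b` implies `ω a ≤ ω b`. -/
def NatLabeled {α : Type*} [PartialOrder α] (ω : α → ℕ) : Prop :=
  ∀ a b : α, a ≤ b → ω a ≤ ω b

/-- A map with all its values at least `1` whose fibres over all `m ≠ 1` are empty is
constantly `1`. -/
theorem eq_one_of_ncard_preimage {α : Type*} [Finite α] {f : α → ℕ} {n : ℕ}
    (h₁ : ∀ a, 1 ≤ f a)
    (hw : ∀ m : ℕ, 1 ≤ m → (f ⁻¹' {m}).ncard = Finsupp.single 1 n m) (a : α) : f a = 1 := by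
  by_contra hne
  have hcard := hw (f a) (h₁ a)
  rw [Finsupp.single_eq_of_ne hne, Set.ncard_eq_zero (Set.toFinite _)] at hcard
  exact Set.eq_empty_iff_forall_notMem.mp hcard a rfl

/-- A naturally labeled poset has exactly one partition with all parts equal to `1`. -/
theorem NatLabeled.ptnCount_single_one {α : Type*} [PartialOrder α] [Finite α] {ω : α → ℕ}
    (hω : NatLabeled ω) : ptnCount ω (Finsupp.single 1 (Nat.card α)) = 1 := by
  rw [ptnCount, Set.ncard_eq_one]
  refine ⟨fun _ => 1, Set.eq_singleton_iff_unique_mem.mpr ⟨⟨⟨fun _ => le_rfl, fun _ _ _ => le_rfl,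
    fun a b hab hlt => absurd (hω a b hab) hlt.not_ge⟩, fun m _ => ?_⟩, ?_⟩⟩
  · by_cases hm : m = 1
    · subst hm
      simp [Set.ncard_univ]
    · simp [Set.preimage_const_of_notMem, hm, Ne.symm hm]
  · exact fun f hf => funext (eq_one_of_ncard_preimage hf.1.1 hf.2)

/-- A labeled poset having a partition with all parts equal to `1` is naturally labeled. -/
theorem natLabeled_of_ptnCount_single_one_ne_zero {α : Type*} [PartialOrder α] [Finite α]
    {ω : α → ℕ} {n : ℕ} (h : ptnCount ω (Finsupp.single 1 n) ≠ 0) : NatLabeled ω := by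
  obtain ⟨f, hf, hw⟩ := Set.nonempty_of_ncard_ne_zero h
  intro a b hab
  by_contra! hlt
  have hf_lt := hf.2.2 a b hab hlt
  rw [eq_one_of_ncard_preimage hf.1 hw a, eq_one_of_ncard_preimage hf.1 hw b] at hf_lt
  exact lt_irrefl _ hf_lt


/-- If `(P,ω)` is naturally labeled and `(P,ω) ~ (Q,τ)`, then `(Q,τ)` is naturally
labeled as well. -/
theorem stmt3 {α β : Type*} [PartialOrder α] [Fintype α] [PartialOrder β] [Fintype β]
    (ω : α → ℕ) (τ : β → ℕ) (hω : IsLabeling ω) (hτ : IsLabeling τ)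
    (hnat : NatLabeled ω) (h : KEq ω τ) : NatLabeled τ := by
  refine natLabeled_of_ptnCount_single_one_ne_zero (n := Nat.card α) ?_
  rw [← h, hnat.ptnCount_single_one]
  exact one_ne_zero
end

section
/- For labeled posets (P,ω) and (Q,τ), the following are equivalent: (i) (P,ω) ~ (Q,τ); (ii) (P,ω)‾ ~ (Q,τ)‾; (iii) (P,ω)* ~ (Q,τ)*. -/
/-- The label part of the bar involution `(P,ω)‾ = (P, ω′)`, `ω′(a) = n+1−ω(a)`
(switching strict and weak edges). -/
def barLabel {α : Type*} [Fintype α] (ω : α → ℕ) : α → ℕ :=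
  fun a => Fintype.card α + 1 - ω a

/-- The label of the star involution `(P,ω)* = (P*, ω′)` on the dual poset `αᵒᵈ`. -/
def starLabel {α : Type*} [Fintype α] (ω : α → ℕ) : αᵒᵈ → ℕ :=
  fun a => Fintype.card α + 1 - ω (OrderDual.ofDual a)

/-- The linear extensions of a poset, as order-compatible enumerations by `Fin n`. -/
def LinExt (α : Type*) [PartialOrder α] (n : ℕ) : Type _ :=
  {π : Fin n ≃ α // ∀ a b : α, a ≤ b → π.symm a ≤ π.symm b}

/-- The positions `i` for which `i + 1` is a position with a strictly smaller label. -/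
noncomputable def descents {α : Type*} {n : ℕ} (ω : α → ℕ) (π : Fin n ≃ α) : Finset (Fin n) :=
  open Classical in
  Finset.univ.filter fun i => ∃ j : Fin n, (j : ℕ) = i + 1 ∧ ω (π j) < ω (π i)

/-- The positions `i` for which `i + 1` is a position. -/
noncomputable def steps (n : ℕ) : Finset (Fin n) :=
  open Classical in
  Finset.univ.filter fun i => ∃ j : Fin n, (j : ℕ) = i + 1

/-- The positions at which a sequence strictly increases. -/
noncomputable def ascents {n : ℕ} (v : Fin n → ℕ) : Finset (Fin n) :=
  open Classical in
  Finset.univ.filter fun i => ∃ j : Fin n, (j : ℕ) = i + 1 ∧ v i < v j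

lemma mem_descents {α : Type*} {n : ℕ} {ω : α → ℕ} {π : Fin n ≃ α} {i : Fin n} :
    i ∈ descents ω π ↔ ∃ j : Fin n, (j : ℕ) = i + 1 ∧ ω (π j) < ω (π i) := by
  simp [descents]

lemma mem_steps {n : ℕ} {i : Fin n} : i ∈ steps n ↔ ∃ j : Fin n, (j : ℕ) = i + 1 := by
  simp [steps]

lemma mem_ascents {n : ℕ} {v : Fin n → ℕ} {i : Fin n} :
    i ∈ ascents v ↔ ∃ j : Fin n, (j : ℕ) = i + 1 ∧ v i < v j := by
  simp [ascents]

/-- Functions with equinumerous fibres differ by a bijection of their domains. -/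
lemma exists_equiv_of_ncard_fiber {α β : Type*} [Finite α] [Finite β] {f : α → ℕ} {g : β → ℕ}
    (hf : ∀ a, 1 ≤ f a) (hg : ∀ b, 1 ≤ g b)
    (h : ∀ m : ℕ, 1 ≤ m → (f ⁻¹' {m}).ncard = (g ⁻¹' {m}).ncard) :
    ∃ e : α ≃ β, ∀ a, g (e a) = f a := by
  have key : ∀ m, Nonempty ({a // f a = m} ≃ {b // g b = m}) := by
    intro m
    rcases Nat.eq_zero_or_pos m with rfl | hm
    · have : IsEmpty {a // f a = 0} := ⟨fun a => by have := hf a; have := a.2; omega⟩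
      have : IsEmpty {b // g b = 0} := ⟨fun b => by have := hg b; have := b.2; omega⟩
      exact ⟨Equiv.equivOfIsEmpty _ _⟩
    · have := Fintype.ofFinite {a // f a = m}
      have := Fintype.ofFinite {b // g b = m}
      exact Fintype.card_eq.1 (by
        rw [← Nat.card_eq_fintype_card, ← Nat.card_eq_fintype_card]
        exact h m hm)
  exact ⟨Equiv.ofFiberEquiv fun m => (key m).some, fun a => Equiv.ofFiberEquiv_map _ a⟩

lemma exists_sorting {α γ : Type*} [Fintype α] [LinearOrder γ] {n : ℕ}
    (hn : Fintype.card α = n) {g : α → γ} (hg : Function.Injective g) :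
    ∃ π : Fin n ≃ α, StrictMono (g ∘ π) := by
  let _ : LinearOrder α := LinearOrder.lift' g hg
  exact ⟨(monoEquivOfFin α hn).toEquiv, fun i j hij => (monoEquivOfFin α hn).strictMono hij⟩

lemma strictMono_of_step {γ : Type*} [Preorder γ] {n : ℕ} {u : Fin n → γ}
    (h : ∀ i j : Fin n, (j : ℕ) = i + 1 → u i < u j) : StrictMono u := by
  cases n with
  | zero => exact fun i => i.elim0
  | succ n => exact Fin.strictMono_iff_lt_succ.2 fun i => h _ _ (by simp)

/-- Compatibility of a sequence with an enumeration, as lexicographic monotonicity. -/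
lemma descents_subset_ascents_iff {α : Type*} {n : ℕ} {ω : α → ℕ} (hω : Function.Injective ω)
    {v : Fin n → ℕ} (hv : Monotone v) (π : Fin n ≃ α) :
    descents ω π ⊆ ascents v ↔ StrictMono fun i => toLex (v i, ω (π i)) := by
  constructor
  · intro h
    refine strictMono_of_step fun i j hij => ?_
    rw [Prod.Lex.toLex_lt_toLex]
    have hlt : i < j := by rw [Fin.lt_def]; omega
    by_cases hd : ω (π j) < ω (π i)
    · obtain ⟨k, hk, hvk⟩ := mem_ascents.1 (h (mem_descents.2 ⟨j, hij, hd⟩))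
      obtain rfl : k = j := Fin.ext (by omega)
      exact Or.inl hvk
    · have hne : ω (π i) ≠ ω (π j) := fun he => hlt.ne (π.injective (hω he))
      rcases (hv hlt.le).lt_or_eq with hlt' | heq
      · exact Or.inl hlt'
      · exact Or.inr ⟨heq, by simp only; omega⟩
  · intro h i hi
    obtain ⟨j, hij, hd⟩ := mem_descents.1 hi
    have hlt : i < j := by rw [Fin.lt_def]; omega
    have := h hlt
    rw [Prod.Lex.toLex_lt_toLex] at this
    rcases this with hlt' | ⟨-, hlt'⟩
    · exact mem_ascents.2 ⟨j, hij, hlt'⟩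
    · simp only at hlt'; omega

/-- A `(P,ω)`-partition is sorted by some linear extension, breaking ties by the labels. -/
lemma IsPtn.exists_sorting {α : Type*} [PartialOrder α] [Fintype α] {n : ℕ}
    (hn : Fintype.card α = n) {ω : α → ℕ} (hω : Function.Injective ω) {f : α → ℕ}
    (hf : IsPtn ω f) :
    ∃ π : LinExt α n, Monotone (f ∘ π.1) ∧ descents ω π.1 ⊆ ascents (f ∘ π.1) := by
  have hinj : Function.Injective fun a => toLex (f a, ω a) := fun a b hab =>
    hω (congrArg (fun x => (ofLex x).2) hab)
  obtain ⟨π, hπ⟩ := _root_.exists_sorting hn hinj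
  have hmono : Monotone (f ∘ π) := fun i j hij => by
    have := hπ.monotone hij
    simp only [Function.comp_apply, Prod.Lex.toLex_le_toLex] at this ⊢
    omega
  refine ⟨⟨π, fun a b hab => ?_⟩, hmono, (descents_subset_ascents_iff hω hmono π).2 hπ⟩
  rw [← hπ.le_iff_le]
  simp only [Function.comp_apply, Equiv.apply_symm_apply, Prod.Lex.toLex_le_toLex]
  have h₁ := hf.2.1 a b hab
  have h₂ := hf.2.2 a b hab
  omega

lemma ncard_preimage_comp_equiv {ι κ : Type*} (f : κ → ℕ) (e : ι ≃ κ) (m : ℕ) :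
    ((f ∘ e) ⁻¹' {m}).ncard = (f ⁻¹' {m}).ncard := by
  rw [Set.preimage_comp]
  exact Set.ncard_preimage_of_injective_subset_range e.injective (by simp)

/-- Stanley's fundamental lemma: the `(P,ω)`-partitions of a given weight correspond to the
linear extensions whose descents occur at ascents of the sorted sequence of that weight. -/
lemma ptnCount_eq_card_linExt {α : Type*} [PartialOrder α] [Fintype α] {n : ℕ}
    (hn : Fintype.card α = n) {ω : α → ℕ} (hω : Function.Injective ω) {v : Fin n → ℕ}
    (hv : Monotone v) (hv₁ : ∀ i, 1 ≤ v i) {w : ℕ →₀ ℕ}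
    (hw : ∀ m : ℕ, 1 ≤ m → (v ⁻¹' {m}).ncard = w m) :
    ptnCount ω w = Nat.card {π : LinExt α n // descents ω π.1 ⊆ ascents v} := by
  symm
  refine Nat.card_congr (Equiv.ofBijective (fun π => ⟨v ∘ π.1.1.symm, ?_, ?_⟩) ⟨?_, ?_⟩)
  · obtain ⟨⟨π, hπ⟩, hd⟩ := π
    rw [descents_subset_ascents_iff hω hv] at hd
    refine ⟨fun a => hv₁ _, fun a b hab => hv (hπ a b hab), fun a b hab hlt => ?_⟩
    have := hd.monotone (hπ a b hab)
    simp only [Equiv.apply_symm_apply, Prod.Lex.toLex_le_toLex] at this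
    simp only [Function.comp_apply]
    omega
  · intro m hm
    rw [ncard_preimage_comp_equiv, hw m hm]
  · rintro ⟨⟨π, hπ⟩, hd⟩ ⟨⟨ρ, hρ⟩, hd'⟩ heq
    rw [descents_subset_ascents_iff hω hv] at hd hd'
    have hvf : v ∘ π.symm = v ∘ ρ.symm := congrArg Subtype.val heq
    have hg : ∀ σ : Fin n ≃ α, (fun i => toLex (v i, ω (σ i)))
        = (fun a => toLex (v (σ.symm a), ω a)) ∘ σ := fun σ => by simp [Function.comp_def]
    have hfg : (fun a => toLex (v (π.symm a), ω a)) = fun a => toLex (v (ρ.symm a), ω a) := by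
      funext a
      rw [show v (π.symm a) = v (ρ.symm a) from congrFun hvf a]
    have hrange : Set.range (fun i => toLex (v i, ω (π i)))
        = Set.range (fun i => toLex (v i, ω (ρ i))) := by
      rw [hg π, hg ρ, EquivLike.range_comp, EquivLike.range_comp, hfg]
    have hfun := (StrictMono.range_inj hd hd').1 hrange
    have : π = ρ := Equiv.ext fun i =>
      hω (congrArg (fun x => (ofLex x).2) (congrFun hfun i))
    subst this
    rfl
  · rintro ⟨f, hf, hfw⟩
    obtain ⟨π, hmono, hd⟩ := hf.exists_sorting hn hω
    obtain ⟨e, he⟩ := exists_equiv_of_ncard_fiber (f := f ∘ π.1) (g := v)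
      (fun i => hf.1 _) hv₁ fun m hm => by
        rw [ncard_preimage_comp_equiv, hfw m hm, hw m hm]
    have hve : v ∘ e = f ∘ π.1 := funext he
    have hfv : f ∘ π.1 = v := by
      rw [← hve] at hmono ⊢
      exact Tuple.unique_monotone (τ := Equiv.refl _) hmono hv
    refine ⟨⟨π, hfv ▸ hd⟩, Subtype.ext ?_⟩
    simp [← hfv, Function.comp_assoc]

/-- Every function from a finite type to the natural numbers has a weight. -/
lemma exists_weight {ι : Type*} [Fintype ι] (v : ι → ℕ) :
    ∃ w : ℕ →₀ ℕ, ∀ m : ℕ, (v ⁻¹' {m}).ncard = w m := by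
  classical
  refine ⟨Finsupp.onFinset (Finset.univ.image v) (fun m => (v ⁻¹' {m}).ncard) fun m hm => ?_,
    fun m => rfl⟩
  obtain ⟨i, hi⟩ := Set.nonempty_of_ncard_ne_zero hm
  exact Finset.mem_image.2 ⟨i, Finset.mem_univ _, hi⟩

lemma finite_setOf_isPtn {α : Type*} [PartialOrder α] [Finite α] (ω : α → ℕ) (w : ℕ →₀ ℕ) :
    {f : α → ℕ | IsPtn ω f ∧ ∀ m : ℕ, 1 ≤ m → (f ⁻¹' {m}).ncard = w m}.Finite := by
  refine (Set.Finite.pi fun _ : α => w.support.finite_toSet).subset fun f hf a _ => ?_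
  rw [Finset.mem_coe, Finsupp.mem_support_iff, ← hf.2 _ (hf.1.1 a)]
  exact ((Set.ncard_pos (Set.toFinite (f ⁻¹' {f a}))).2 ⟨a, rfl⟩).ne'

lemma exists_isPtn {α : Type*} [PartialOrder α] [Finite α] (ω : α → ℕ) :
    ∃ f : α → ℕ, IsPtn ω f := by
  have hlt : ∀ a b : α, a < b → (Set.Iic a).ncard < (Set.Iic b).ncard := fun a b hab =>
    Set.ncard_lt_ncard (Set.Iic_ssubset_Iic.2 hab)
  refine ⟨fun a => (Set.Iic a).ncard, fun a => (Set.ncard_pos (Set.toFinite _)).2 ⟨a, le_rfl⟩,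
    fun a b hab => Set.ncard_le_ncard (Set.Iic_subset_Iic.2 hab), fun a b hab hω => ?_⟩
  refine hlt a b (lt_of_le_of_ne hab ?_)
  rintro rfl
  exact lt_irrefl _ hω

lemma KEq.card_eq {α β : Type*} [PartialOrder α] [Fintype α] [PartialOrder β] [Fintype β]
    {ω : α → ℕ} {τ : β → ℕ} (h : KEq ω τ) : Fintype.card β = Fintype.card α := by
  obtain ⟨f, hf⟩ := exists_isPtn ω
  obtain ⟨w, hw⟩ := exists_weight f
  have hpos : 0 < ptnCount ω w :=
    (Set.ncard_pos (finite_setOf_isPtn ω w)).2 ⟨f, hf, fun m _ => hw m⟩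
  rw [h w] at hpos
  obtain ⟨g, hg, hgw⟩ := (Set.ncard_pos (finite_setOf_isPtn τ w)).1 hpos
  obtain ⟨e, -⟩ := exists_equiv_of_ncard_fiber hg.1 hf.1 fun m hm => by rw [hgw m hm, hw m]
  exact Fintype.card_congr e

instance (α : Type*) [PartialOrder α] [Finite α] (n : ℕ) : Finite (LinExt α n) :=
  Subtype.finite

open Classical in
lemma card_subset_eq_add_sum {ι A : Type*} [Fintype A] (d : A → Finset ι) (S : Finset ι) :
    Nat.card {a // d a ⊆ S} = (Finset.univ.filter fun a => d a = S).card
      + ∑ T ∈ S.ssubsets, (Finset.univ.filter fun a => d a = T).card := by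
  rw [Finset.ssubsets, Finset.add_sum_erase _ (fun T => (Finset.univ.filter fun a => d a = T).card)
    (Finset.mem_powerset_self S), Nat.card_eq_fintype_card, Fintype.card_subtype,
    Finset.card_eq_sum_card_fiberwise (f := d) (t := S.powerset) fun a ha => by simpa using ha]
  refine Finset.sum_congr rfl fun T hT => ?_
  rw [Finset.filter_filter]
  congr 1
  ext a
  simp only [Finset.mem_filter, Finset.mem_univ, true_and, and_iff_right_iff_imp]
  rintro rfl
  exact Finset.mem_powerset.1 hT

/-- Möbius inversion on the Boolean lattice, in enumerative form: set-valued statistics with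
equinumerous sublevel sets are equidistributed. -/
lemma exists_equiv_of_card_subset {ι A B : Type*} [Finite A] [Finite B]
    (d : A → Finset ι) (d' : B → Finset ι)
    (h : ∀ S, Nat.card {a // d a ⊆ S} = Nat.card {b // d' b ⊆ S}) :
    ∃ e : A ≃ B, ∀ a, d' (e a) = d a := by
  classical
  have := Fintype.ofFinite A
  have := Fintype.ofFinite B
  have key : ∀ S, (Finset.univ.filter fun a => d a = S).card
      = (Finset.univ.filter fun b => d' b = S).card := by
    intro S
    induction S using Finset.strongInduction with
    | H S ih =>
      have hS := h S
      rw [card_subset_eq_add_sum, card_subset_eq_add_sum,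
        Finset.sum_congr rfl fun T hT => ih T (Finset.mem_ssubsets.1 hT)] at hS
      exact Nat.add_right_cancel hS
  have key' : ∀ S, Nonempty ({a // d a = S} ≃ {b // d' b = S}) := fun S => by
    refine ⟨Fintype.equivOfCardEq ?_⟩
    rw [Fintype.card_subtype, Fintype.card_subtype, key]
  exact ⟨Equiv.ofFiberEquiv fun S => (key' S).some, fun a => Equiv.ofFiberEquiv_map _ a⟩

/-- Every set of steps is the ascent set of a monotone sequence. -/
lemma exists_ascents_eq {n : ℕ} (S : Finset (Fin n)) :
    ∃ v : Fin n → ℕ, Monotone v ∧ (∀ i, 1 ≤ v i) ∧ ascents v = S ∩ steps n := by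
  classical
  refine ⟨fun i => 1 + (S.filter (· < i)).card, fun i j hij => ?_, fun i => Nat.le_add_right _ _, ?_⟩
  · refine Nat.add_le_add_left (Finset.card_le_card fun k hk => ?_) 1
    rw [Finset.mem_filter] at hk ⊢
    exact ⟨hk.1, hk.2.trans_le hij⟩
  · have hstep : ∀ i j : Fin n, (j : ℕ) = i + 1 →
        ((S.filter (· < i)).card < (S.filter (· < j)).card ↔ i ∈ S) := by
      intro i j hij
      by_cases hi : i ∈ S
      · refine iff_of_true (Finset.card_lt_card ?_) hi
        rw [Finset.ssubset_iff_of_subset fun k hk => ?_]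
        · exact ⟨i, by simp [hi, Fin.lt_def.2 (show (i : ℕ) < j by omega)]⟩
        · simp only [Finset.mem_filter, Fin.lt_def] at hk ⊢
          exact ⟨hk.1, by omega⟩
      · refine iff_of_false (not_lt.2 (Finset.card_le_card fun k hk => ?_)) hi
        have hne : k ≠ i := by rintro rfl; exact hi (Finset.mem_filter.1 hk).1
        have := Fin.val_ne_of_ne hne
        simp only [Finset.mem_filter, Fin.lt_def] at hk ⊢
        exact ⟨hk.1, by omega⟩
    ext i
    simp only [mem_ascents, Finset.mem_inter, mem_steps, Nat.add_lt_add_iff_left]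
    constructor
    · rintro ⟨j, hij, hlt⟩
      exact ⟨(hstep i j hij).1 hlt, j, hij⟩
    · rintro ⟨hi, j, hij⟩
      exact ⟨j, hij, (hstep i j hij).2 hi⟩

lemma descents_subset_steps {α : Type*} {n : ℕ} (ω : α → ℕ) (π : Fin n ≃ α) :
    descents ω π ⊆ steps n := fun i hi => by
  obtain ⟨j, hij, -⟩ := mem_descents.1 hi
  exact mem_steps.2 ⟨j, hij⟩

/-- The generating function determines the descent set distribution of linear extensions. -/
lemma KEq.exists_equiv_linExt {α β : Type*} [PartialOrder α] [Fintype α] [PartialOrder β]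
    [Fintype β] {n : ℕ} (hα : Fintype.card α = n) (hβ : Fintype.card β = n)
    {ω : α → ℕ} {τ : β → ℕ} (hω : Function.Injective ω) (hτ : Function.Injective τ)
    (h : KEq ω τ) :
    ∃ e : LinExt α n ≃ LinExt β n, ∀ π, descents τ (e π).1 = descents ω π.1 := by
  refine exists_equiv_of_card_subset (fun π : LinExt α n => descents ω π.1)
    (fun π : LinExt β n => descents τ π.1) fun S => ?_
  obtain ⟨v, hv, hv₁, hvS⟩ := exists_ascents_eq S
  obtain ⟨w, hw⟩ := exists_weight v
  have := h w
  rw [ptnCount_eq_card_linExt hα hω hv hv₁ fun m _ => hw m,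
    ptnCount_eq_card_linExt hβ hτ hv hv₁ fun m _ => hw m, hvS] at this
  simpa only [Finset.subset_inter_iff, descents_subset_steps, and_true] using this

lemma ptnCount_eq_zero {α : Type*} [PartialOrder α] [Fintype α] {n : ℕ}
    (hn : Fintype.card α = n) {ω : α → ℕ} (hω : Function.Injective ω) {w : ℕ →₀ ℕ}
    (hw : ¬ ∃ v : Fin n → ℕ, Monotone v ∧ (∀ i, 1 ≤ v i) ∧
      ∀ m : ℕ, 1 ≤ m → (v ⁻¹' {m}).ncard = w m) : ptnCount ω w = 0 := by
  by_contra hne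
  obtain ⟨f, hf, hfw⟩ := Set.nonempty_of_ncard_ne_zero hne
  obtain ⟨π, hmono, -⟩ := hf.exists_sorting hn hω
  exact hw ⟨f ∘ π.1, hmono, fun i => hf.1 _, fun m hm => by
    rw [ncard_preimage_comp_equiv, hfw m hm]⟩

/-- The descent set distribution of linear extensions determines the generating function. -/
lemma KEq.of_equiv_linExt {α β : Type*} [PartialOrder α] [Fintype α] [PartialOrder β]
    [Fintype β] {n : ℕ} (hα : Fintype.card α = n) (hβ : Fintype.card β = n)
    {ω : α → ℕ} {τ : β → ℕ} (hω : Function.Injective ω) (hτ : Function.Injective τ)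
    (e : LinExt α n ≃ LinExt β n) (he : ∀ π, descents τ (e π).1 = descents ω π.1) :
    KEq ω τ := by
  intro w
  by_cases hex : ∃ v : Fin n → ℕ, Monotone v ∧ (∀ i, 1 ≤ v i) ∧
      ∀ m : ℕ, 1 ≤ m → (v ⁻¹' {m}).ncard = w m
  · obtain ⟨v, hv, hv₁, hw⟩ := hex
    rw [ptnCount_eq_card_linExt hα hω hv hv₁ hw, ptnCount_eq_card_linExt hβ hτ hv hv₁ hw]
    exact Nat.card_congr (e.subtypeEquiv fun π => by rw [he])
  · rw [ptnCount_eq_zero hα hω hex, ptnCount_eq_zero hβ hτ hex]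

/-- `KEq` is preserved by operations that act on linear extensions so that the new descent set
is a function of the old one. -/
lemma KEq.transfer {α α' β β' : Type*} [PartialOrder α] [Fintype α] [PartialOrder α']
    [Fintype α'] [PartialOrder β] [Fintype β] [PartialOrder β'] [Fintype β']
    {ω : α → ℕ} {ω' : α' → ℕ} {τ : β → ℕ} {τ' : β' → ℕ}
    (hω : Function.Injective ω) (hω' : Function.Injective ω')
    (hτ : Function.Injective τ) (hτ' : Function.Injective τ')
    (hα : Fintype.card α' = Fintype.card α) (hβ : Fintype.card β' = Fintype.card β)
    (F : ∀ n, Finset (Fin n) → Finset (Fin n))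
    (r : ∀ n, LinExt α n ≃ LinExt α' n) (s : ∀ n, LinExt β n ≃ LinExt β' n)
    (hr : ∀ n π, descents ω' (r n π).1 = F n (descents ω π.1))
    (hs : ∀ n π, descents τ' (s n π).1 = F n (descents τ π.1))
    (h : KEq ω τ) : KEq ω' τ' := by
  have hc := h.card_eq
  obtain ⟨e, he⟩ := h.exists_equiv_linExt rfl hc hω hτ
  refine KEq.of_equiv_linExt hα (hβ.trans hc) hω' hτ' ((r _).symm.trans (e.trans (s _)))
    fun π => ?_
  obtain ⟨ρ, rfl⟩ := (r _).surjective π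
  simp [hr, hs, he]

lemma descents_of_lt_iff {α : Type*} {ω ω' : α → ℕ} (hω : Function.Injective ω)
    (h : ∀ a b, ω' a < ω' b ↔ ω b < ω a) {n : ℕ} (π : Fin n ≃ α) :
    descents ω' π = steps n \ descents ω π := by
  ext i
  simp only [Finset.mem_sdiff, mem_steps, mem_descents, h, not_exists, not_and, not_lt]
  constructor
  · rintro ⟨j, hij, hlt⟩
    refine ⟨⟨j, hij⟩, fun k hk => ?_⟩
    obtain rfl : k = j := Fin.ext (by omega)
    exact hlt.le
  · rintro ⟨⟨j, hij⟩, hle⟩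
    refine ⟨j, hij, lt_of_le_of_ne (hle j hij) fun heq => ?_⟩
    have := congrArg Fin.val (π.injective (hω heq))
    omega

lemma KEq.of_reversed_labels {α β : Type*} [PartialOrder α] [Fintype α] [PartialOrder β]
    [Fintype β] {ω ω' : α → ℕ} {τ τ' : β → ℕ}
    (hω : Function.Injective ω) (hω' : Function.Injective ω')
    (hτ : Function.Injective τ) (hτ' : Function.Injective τ')
    (hωω' : ∀ a b, ω' a < ω' b ↔ ω b < ω a) (hττ' : ∀ a b, τ' a < τ' b ↔ τ b < τ a)
    (h : KEq ω τ) : KEq ω' τ' :=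
  KEq.transfer hω hω' hτ hτ' rfl rfl (fun n S => steps n \ S) (fun _ => Equiv.refl _)
    (fun _ => Equiv.refl _) (fun _ π => descents_of_lt_iff hω hωω' π.1)
    (fun _ π => descents_of_lt_iff hτ hττ' π.1) h

/-- Reading a linear extension backwards gives a linear extension of an anti-isomorphic poset. -/
def LinExt.reverse {α α' : Type*} [PartialOrder α] [PartialOrder α'] (e : α ≃ α')
    (he : ∀ a b, e a ≤ e b ↔ b ≤ a) (n : ℕ) : LinExt α n ≃ LinExt α' n :=
  ((Fin.revPerm.equivCongr e) : (Fin n ≃ α) ≃ (Fin n ≃ α')).subtypeEquiv fun π => by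
    constructor
    · intro h a b hab
      have := h (e.symm b) (e.symm a) (by rw [← he]; simpa using hab)
      simpa [Equiv.equivCongr] using this
    · intro h a b hab
      have := h (e b) (e a) ((he b a).2 hab)
      simpa [Equiv.equivCongr] using this

lemma descents_reverse {α α' : Type*} [PartialOrder α] [PartialOrder α'] {ω : α → ℕ}
    {ω' : α' → ℕ} (e : α ≃ α') (he : ∀ a b, e a ≤ e b ↔ b ≤ a)
    (h : ∀ a b, ω' (e a) < ω' (e b) ↔ ω b < ω a) (n : ℕ) (π : LinExt α n) :
    descents ω' (LinExt.reverse e he n π).1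
      = Finset.univ.filter fun i : Fin n =>
        ∃ j : Fin n, (j : ℕ) = i + 1 ∧ j.rev ∈ descents ω π.1 := by
  have hval : ∀ i, (LinExt.reverse e he n π).1 i = e (π.1 i.rev) := fun i => rfl
  ext i
  simp only [Finset.mem_filter, Finset.mem_univ, true_and, mem_descents, hval, h]
  constructor
  · rintro ⟨j, hij, hlt⟩
    exact ⟨j, hij, i.rev, by simp only [Fin.val_rev]; omega, hlt⟩
  · rintro ⟨j, hij, k, hk, hlt⟩
    obtain rfl : k = i.rev := Fin.ext (by simp only [Fin.val_rev] at hk ⊢; omega)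
    exact ⟨j, hij, hlt⟩

lemma KEq.of_antiIso {α α' β β' : Type*} [PartialOrder α] [Fintype α] [PartialOrder α']
    [Fintype α'] [PartialOrder β] [Fintype β] [PartialOrder β'] [Fintype β']
    {ω : α → ℕ} {ω' : α' → ℕ} {τ : β → ℕ} {τ' : β' → ℕ}
    (hω : Function.Injective ω) (hω' : Function.Injective ω')
    (hτ : Function.Injective τ) (hτ' : Function.Injective τ')
    (e : α ≃ α') (he : ∀ a b, e a ≤ e b ↔ b ≤ a)
    (heω : ∀ a b, ω' (e a) < ω' (e b) ↔ ω b < ω a)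
    (u : β ≃ β') (hu : ∀ a b, u a ≤ u b ↔ b ≤ a)
    (huτ : ∀ a b, τ' (u a) < τ' (u b) ↔ τ b < τ a)
    (h : KEq ω τ) : KEq ω' τ' :=
  KEq.transfer hω hω' hτ hτ' (Fintype.card_congr e.symm) (Fintype.card_congr u.symm)
    (fun n S => Finset.univ.filter fun i : Fin n => ∃ j : Fin n, (j : ℕ) = i + 1 ∧ j.rev ∈ S)
    (LinExt.reverse e he) (LinExt.reverse u hu) (descents_reverse e he heω)
    (descents_reverse u hu huτ) h

lemma IsLabeling.injective {α : Type*} {ω : α → ℕ} (h : IsLabeling ω) : Function.Injective ω :=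
  Set.injOn_univ.1 h.injOn

lemma IsLabeling.barLabel_lt_iff {α : Type*} [Fintype α] {ω : α → ℕ} (h : IsLabeling ω)
    (a b : α) : barLabel ω a < barLabel ω b ↔ ω b < ω a := by
  have ha := (h.mapsTo (Set.mem_univ a)).2
  have hb := (h.mapsTo (Set.mem_univ b)).2
  rw [Nat.card_eq_fintype_card] at ha hb
  simp only [barLabel]
  omega

lemma IsLabeling.barLabel_injective {α : Type*} [Fintype α] {ω : α → ℕ} (h : IsLabeling ω) :
    Function.Injective (barLabel ω) := fun a b hab => by
  have h₁ := h.barLabel_lt_iff a b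
  have h₂ := h.barLabel_lt_iff b a
  exact h.injective (by omega)

/-- For labeled posets `(P,ω)`, `(Q,τ)` the following are equivalent:
(i) `(P,ω) ~ (Q,τ)`; (ii) `(P,ω)‾ ~ (Q,τ)‾`; (iii) `(P,ω)* ~ (Q,τ)*`. -/
theorem stmt7 {α β : Type*} [PartialOrder α] [Fintype α] [PartialOrder β] [Fintype β]
    (ω : α → ℕ) (τ : β → ℕ) (hω : IsLabeling ω) (hτ : IsLabeling τ) :
    (KEq ω τ ↔ KEq (barLabel ω) (barLabel τ)) ∧
    (KEq ω τ ↔ KEq (starLabel ω) (starLabel τ)) := by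
  have hω' := hω.barLabel_injective
  have hτ' := hτ.barLabel_injective
  have bω := hω.barLabel_lt_iff
  have bτ := hτ.barLabel_lt_iff
  have sω : Function.Injective (starLabel ω) := hω'
  have sτ : Function.Injective (starLabel τ) := hτ'
  refine ⟨⟨?_, ?_⟩, ⟨?_, ?_⟩⟩
  · exact KEq.of_reversed_labels hω.injective hω' hτ.injective hτ' bω bτ
  · exact KEq.of_reversed_labels hω' hω.injective hτ' hτ.injective
      (fun a b => (bω b a).symm) (fun a b => (bτ b a).symm)
  · exact KEq.of_antiIso hω.injective sω hτ.injective sτ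
      OrderDual.toDual (fun _ _ => Iff.rfl) bω OrderDual.toDual (fun _ _ => Iff.rfl) bτ
  · exact KEq.of_antiIso sω hω.injective sτ hτ.injective
      OrderDual.ofDual (fun _ _ => Iff.rfl) (fun a b => (bω b a).symm)
      OrderDual.ofDual (fun _ _ => Iff.rfl) (fun a b => (bτ b a).symm)
end

section
/- If (P,ω) and (Q,τ) are naturally labeled posets with (P,ω) ~ (Q,τ), then P and Q have the same width, i.e., the maximum cardinality of an antichain in P equals the maximum cardinality of an antichain in Q. -/
/-- The width of the poset `α`: the maximum cardinality of an antichain. -/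
noncomputable def posetWidth (α : Type*) [PartialOrder α] : ℕ :=
  sSup {k : ℕ | ∃ s : Set α, IsAntichain (· ≤ ·) s ∧ s.ncard = k}

/-- The order-preserving maps of weight `w` whose fibre over `2` is an antichain. -/
def antichainPtns (α : Type*) [PartialOrder α] (w : ℕ →₀ ℕ) : Set (α → ℕ) :=
  {f | Monotone f ∧ (∀ a, 1 ≤ f a) ∧ (∀ m, 1 ≤ m → (f ⁻¹' {m}).ncard = w m) ∧
    IsAntichain (· ≤ ·) (f ⁻¹' {2})}

/-- The union over `j` of the maps in `antichainPtns` for the weights obtained from `w` by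
distributing `k` elements over the levels `2` and `q`. -/
def splitPtns (α : Type*) [PartialOrder α] (w : ℕ →₀ ℕ) (q k : ℕ) : Set (α → ℕ) :=
  {f | Monotone f ∧ (∀ a, 1 ≤ f a) ∧
    (∀ m, 1 ≤ m → m ≠ 2 → m ≠ q → (f ⁻¹' {m}).ncard = w m) ∧
    IsAntichain (· ≤ ·) (f ⁻¹' {2}) ∧ (f ⁻¹' {2, q}).ncard = k}

theorem neg_one_pow_ncard_update_add {α : Type*} [Finite α] [DecidableEq α] {q : ℕ}
    (hq : 2 < q) {f : α → ℕ} {x : α} (hx : f x = 2 ∨ f x = q) :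
    (-1 : ℤ) ^ (f ⁻¹' {2}).ncard +
      (-1) ^ (Function.update f x (2 + q - f x) ⁻¹' {2}).ncard = 0 := by
  rcases hx with h | h
  · have he : f ⁻¹' {2} = insert x (Function.update f x (2 + q - f x) ⁻¹' {2}) := by
      ext a
      by_cases ha : a = x
      · subst ha; simp [h]
      · simp [ha]
    rw [he, Set.ncard_insert_of_notMem _ (Set.toFinite _), pow_succ]
    · ring
    · simp only [Set.mem_preimage, Function.update_self, Set.mem_singleton_iff]
      omega
  · have he : Function.update f x (2 + q - f x) ⁻¹' {2} = insert x (f ⁻¹' {2}) := by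
      ext a
      by_cases ha : a = x
      · subst ha; simp [h]
      · simp [ha]
    rw [he, Set.ncard_insert_of_notMem _ (Set.toFinite _), pow_succ]
    · ring
    · simp only [Set.mem_preimage, Set.mem_singleton_iff]
      omega

section

variable {α : Type*} [PartialOrder α]

theorem isPtn_iff_of_natLabeled {ω : α → ℕ} (hω : NatLabeled ω) (f : α → ℕ) :
    IsPtn ω f ↔ Monotone f ∧ ∀ a, 1 ≤ f a :=
  ⟨fun h => ⟨fun a b hab => h.2.1 a b hab, h.1⟩, fun h => ⟨h.2, fun _ _ hab => h.1 hab,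
    fun a b hab hlt => absurd (hω a b hab) (not_le.2 hlt)⟩⟩

theorem ncard_antichainPtns_of_eq_zero [Finite α] {ω : α → ℕ} (hω : NatLabeled ω) {w : ℕ →₀ ℕ}
    (hw : w 2 = 0) : (antichainPtns α w).ncard = ptnCount ω w := by
  unfold ptnCount
  congr 1
  ext f
  simp only [antichainPtns, Set.mem_ofPred_eq, isPtn_iff_of_natLabeled hω]
  constructor
  · rintro ⟨h1, h2, h3, -⟩
    exact ⟨⟨h1, h2⟩, h3⟩
  · rintro ⟨⟨h1, h2⟩, h3⟩
    refine ⟨h1, h2, h3, ?_⟩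
    have h0 : f ⁻¹' {2} = ∅ := by
      rw [← Set.ncard_eq_zero (Set.toFinite _), h3 2 (by norm_num), hw]
    rw [h0]
    exact IsAntichain.empty

theorem finite_splitPtns [Finite α] (w : ℕ →₀ ℕ) (q k : ℕ) : (splitPtns α w q k).Finite := by
  refine (Set.Finite.pi' (t := fun _ : α => (↑(w.support ∪ {2, q}) : Set ℕ))
    fun _ => Finset.finite_toSet _).subset ?_
  rintro f ⟨-, h1, h2, -⟩ a
  by_contra hne
  simp only [Finset.coe_union, Set.mem_union, Finset.mem_coe, Finsupp.mem_support_iff,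
    Finset.mem_insert, Finset.mem_singleton, not_or, not_not] at hne
  obtain ⟨hw, hne2, hneq⟩ := hne
  have h0 := h2 (f a) (h1 a) hne2 hneq
  rw [hw, Set.ncard_eq_zero (Set.toFinite _)] at h0
  exact (h0 ▸ (rfl : f a = f a) : a ∈ (∅ : Set α))

theorem antichainPtns_update_eq [Finite α] (w : ℕ →₀ ℕ) {q k j : ℕ} (hq : 2 < q) (hj : j ≤ k) :
    antichainPtns α ((w.update 2 j).update q (k - j)) =
      {f ∈ splitPtns α w q k | (f ⁻¹' {2}).ncard = j} := by
  have hunion (f : α → ℕ) : (f ⁻¹' {2, q}).ncard = (f ⁻¹' {2}).ncard + (f ⁻¹' {q}).ncard := by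
    rw [← Set.ncard_union_eq _ (Set.toFinite _) (Set.toFinite _)]
    · rfl
    · exact Disjoint.preimage f (by simpa using hq.ne)
  ext f
  simp only [antichainPtns, splitPtns, Set.mem_ofPred_eq, hunion, Finsupp.update_apply]
  constructor
  · rintro ⟨h1, h2, h3, h4⟩
    have e2 := h3 2 (by norm_num)
    have eq := h3 q (by omega)
    simp only [if_neg hq.ne, if_true] at e2 eq
    refine ⟨⟨h1, h2, fun m hm hm2 hmq => ?_, h4, by omega⟩, e2⟩
    simpa [hm2, hmq] using h3 m hm
  · rintro ⟨⟨h1, h2, h3, h4, h5⟩, h6⟩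
    refine ⟨h1, h2, fun m hm => ?_, h4⟩
    split_ifs with hmq hm2
    · subst hmq; omega
    · subst hm2; exact h6
    · exact h3 m hm hm2 hmq

/-- Moving a minimal element of the levels `2` and `q` to the other one of these levels preserves
`splitPtns`, provided that the levels in between are empty. -/
theorem update_mem_splitPtns [Finite α] [DecidableEq α] {w : ℕ →₀ ℕ} {q k : ℕ} (hq : 2 < q)
    (hw : ∀ m, 2 < m → m < q → w m = 0) {f : α → ℕ} (hf : f ∈ splitPtns α w q k) {x : α}
    (hx : x ∈ f ⁻¹' {2, q}) (hmin : ∀ y ∈ f ⁻¹' {2, q}, y ≤ x → y = x) {v : ℕ}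
    (hv : v = 2 ∨ v = q) : Function.update f x v ∈ splitPtns α w q k := by
  obtain ⟨h1, h2, h3, h4, h5⟩ := hf
  have hgap (a : α) : f a ≤ 2 ∨ q ≤ f a := by
    by_contra! hc
    have h0 := h3 (f a) (h2 a) (by omega) (by omega)
    rw [hw _ hc.1 hc.2, Set.ncard_eq_zero (Set.toFinite _)] at h0
    exact (h0 ▸ (rfl : f a = f a) : a ∈ (∅ : Set α))
  have hx' : f x = 2 ∨ f x = q := hx
  have hlow (y : α) (hy : y < x) : f y < 2 := by
    have hle := h1 hy.le
    by_contra hc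
    refine hy.ne (hmin y ?_ hy.le)
    have := hgap y
    change f y = 2 ∨ f y = q
    omega
  have hhigh (y : α) (hy : x < y) : q ≤ f y := by
    have hle := h1 hy.le
    rcases hx' with h | h
    · rcases hgap y with hy2 | hy2
      · have : f y = 2 := by omega
        exact absurd hy.le (h4 h this hy.ne)
      · exact hy2
    · omega
  have hmem (m : ℕ) (hm2 : m ≠ 2) (hmq : m ≠ q) :
      Function.update f x v ⁻¹' {m} = f ⁻¹' {m} := by
    ext a
    by_cases ha : a = x
    · subst ha
      simp only [Set.mem_preimage, Function.update_self, Set.mem_singleton_iff]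
      omega
    · simp [ha]
  refine ⟨fun a b hab => ?_, fun a => ?_, fun m hm hm2 hmq => ?_, ?_, ?_⟩
  · rcases hab.eq_or_lt with rfl | hlt
    · rfl
    by_cases ha : a = x
    · subst ha
      rw [Function.update_self, Function.update_of_ne hlt.ne']
      have := hhigh b hlt
      omega
    · by_cases hb : b = x
      · subst hb
        rw [Function.update_self, Function.update_of_ne ha]
        have := hlow a hlt
        omega
      · simpa [ha, hb] using h1 hab
  · by_cases ha : a = x
    · subst ha
      rw [Function.update_self]
      omega
    · simpa [ha] using h2 a
  · rw [hmem m hm2 hmq, h3 m hm hm2 hmq]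
  · have key (z : α) (hz : Function.update f x v z = 2) (hzx : z ≠ x) : ¬ z ≤ x ∧ ¬ x ≤ z := by
      rw [Function.update_of_ne hzx] at hz
      refine ⟨fun hle => ?_, fun hle => ?_⟩
      · have := hlow z (lt_of_le_of_ne hle hzx)
        omega
      · have := hhigh z (lt_of_le_of_ne hle hzx.symm)
        omega
    intro a ha b hb hab
    by_cases hax : a = x
    · subst hax
      exact (key b hb hab.symm).2
    · by_cases hbx : b = x
      · subst hbx
        exact (key a ha hab).1
      · refine h4 ?_ ?_ hab
        · simpa [hax] using ha
        · simpa [hbx] using hb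
  · rw [← h5]
    congr 1
    ext a
    by_cases ha : a = x
    · subst ha
      simp only [Set.mem_preimage, Function.update_self]
      exact ⟨fun _ => hx, fun _ => hv⟩
    · simp [ha]

theorem sum_neg_one_pow_splitPtns [Finite α] {w : ℕ →₀ ℕ} {q k : ℕ} (hq : 2 < q) (hk : 0 < k)
    (hw : ∀ m, 2 < m → m < q → w m = 0) :
    ∑ f ∈ (finite_splitPtns (α := α) w q k).toFinset, (-1 : ℤ) ^ (f ⁻¹' {2}).ncard = 0 := by
  classical
  have hmin (U : Set α) (hU : U.Nonempty) : ∃ x ∈ U, ∀ y ∈ U, y ≤ x → y = x := by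
    obtain ⟨x, hx⟩ := (Set.toFinite U).exists_minimal hU
    exact ⟨x, hx.prop, fun y hy hyx => (hx.eq_of_le hy hyx)⟩
  rcases isEmpty_or_nonempty α with hα | hα
  · refine Finset.sum_eq_zero fun f hf => ?_
    have hcard := ((Set.Finite.mem_toFinset _).1 hf).2.2.2.2
    rw [Set.eq_empty_of_isEmpty (f ⁻¹' {2, q}), Set.ncard_empty] at hcard
    omega
  choose! x hx using hmin
  have hne {f : α → ℕ} (hf : f ∈ splitPtns α w q k) : (f ⁻¹' {2, q}).Nonempty :=
    Set.nonempty_of_ncard_ne_zero (by rw [hf.2.2.2.2]; omega)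
  refine Finset.sum_involution
    (fun f _ => Function.update f (x (f ⁻¹' {2, q})) (2 + q - f (x (f ⁻¹' {2, q}))))
    (fun f hf => ?_) (fun f hf _ => ?_) (fun f hf => ?_) (fun f hf => ?_)
  all_goals
    rw [Set.Finite.mem_toFinset] at hf
    obtain ⟨hxm, hxmin⟩ := hx _ (hne hf)
    have hxv : f (x (f ⁻¹' {2, q})) = 2 ∨ f (x (f ⁻¹' {2, q})) = q := hxm
  · exact neg_one_pow_ncard_update_add hq hxv
  · intro heq
    have := congrFun heq (x (f ⁻¹' {2, q}))
    rw [Function.update_self] at this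
    omega
  · rw [Set.Finite.mem_toFinset]
    exact update_mem_splitPtns hq hw hf hxm hxmin (by omega)
  · have hU : Function.update f (x (f ⁻¹' {2, q})) (2 + q - f (x (f ⁻¹' {2, q}))) ⁻¹' {2, q} =
        f ⁻¹' {2, q} := by
      ext a
      by_cases ha : a = x (f ⁻¹' {2, q})
      · rw [Set.mem_preimage, ha, Function.update_self]
        refine ⟨fun _ => hxm, fun _ => ?_⟩
        change _ = 2 ∨ _ = q
        omega
      · simp [ha]
    simp only [hU, Function.update_self, Function.update_idem]
    rw [show 2 + q - (2 + q - f (x (f ⁻¹' {2, q}))) = f (x (f ⁻¹' {2, q})) by omega,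
      Function.update_eq_self]

theorem sum_neg_one_pow_mul_ncard_antichainPtns [Finite α] {w : ℕ →₀ ℕ} {q k : ℕ} (hq : 2 < q)
    (hk : 0 < k) (hw : ∀ m, 2 < m → m < q → w m = 0) :
    ∑ j ∈ Finset.range (k + 1),
      (-1 : ℤ) ^ j * (antichainPtns α ((w.update 2 j).update q (k - j))).ncard = 0 := by
  classical
  rw [← sum_neg_one_pow_splitPtns (α := α) hq hk hw,
    ← Finset.sum_fiberwise_of_maps_to (t := Finset.range (k + 1))
      (g := fun f : α → ℕ => (f ⁻¹' {2}).ncard)]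
  · refine Finset.sum_congr rfl fun j hj => ?_
    rw [Finset.sum_congr rfl (g := fun _ => (-1 : ℤ) ^ j)
      (fun f hf => by rw [(Finset.mem_filter.1 hf).2]), Finset.sum_const, nsmul_eq_mul, mul_comm,
      antichainPtns_update_eq w hq (Nat.lt_succ_iff.1 (Finset.mem_range.1 hj)),
      ← Set.ncard_coe_finset]
    congr 3
    ext f
    simp
  · intro f hf
    rw [Set.Finite.mem_toFinset] at hf
    rw [Finset.mem_range, Nat.lt_succ_iff, ← hf.2.2.2.2]
    exact Set.ncard_le_ncard (Set.preimage_mono (by simp)) (Set.toFinite _)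

theorem exists_mem_antichainPtns [Finite α] {s : Set α} (hs : IsAntichain (· ≤ ·) s) :
    ∃ w : ℕ →₀ ℕ, w 2 = s.ncard ∧ (∀ m, 2 < m → m < s.ncard + 3 → w m = 0) ∧
      (antichainPtns α w).Nonempty := by
  classical
  let f : α → ℕ := fun a => if a ∈ s then 2 else if ∃ b ∈ s, a ≤ b then 1 else s.ncard + 3
  have hf2 : f ⁻¹' {2} = s := by
    ext a
    simp only [f, Set.mem_preimage, Set.mem_singleton_iff]
    split_ifs with h1 h2 <;> simp [h1]
  have hf0 (m : ℕ) (hm : (f ⁻¹' {m}).ncard ≠ 0) : m = 1 ∨ m = 2 ∨ m = s.ncard + 3 := by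
    obtain ⟨a, ha⟩ := Set.nonempty_of_ncard_ne_zero hm
    simp only [f, Set.mem_preimage, Set.mem_singleton_iff] at ha
    split_ifs at ha <;> omega
  refine ⟨Finsupp.onFinset {1, 2, s.ncard + 3} (fun m => (f ⁻¹' {m}).ncard) fun m hm => by
    simpa using hf0 m hm, ?_, fun m hm hm' => ?_, f, fun a b hab => ?_, fun a => ?_,
    fun m _ => rfl, hf2.symm ▸ hs⟩
  · rw [Finsupp.onFinset_apply, hf2]
  · rw [Finsupp.onFinset_apply]
    by_contra hc
    have := hf0 m hc
    omega
  · simp only [f]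
    split_ifs with ha hb hb' ha' hb hb' hb hb' <;> try omega
    · obtain ⟨c, hc, hbc⟩ := hb'
      obtain rfl := hs.eq ha hc (hab.trans hbc)
      exact absurd (le_antisymm hab hbc ▸ ha) hb
    · exact absurd ⟨b, hb, hab⟩ ha'
    · obtain ⟨c, hc, hbc⟩ := hb'
      exact absurd ⟨c, hc, hab.trans hbc⟩ ha'
  · simp only [f]
    split_ifs <;> omega

theorem finite_antichainPtns [Finite α] (w : ℕ →₀ ℕ) : (antichainPtns α w).Finite := by
  refine (finite_splitPtns w 2 (w 2)).subset ?_
  rintro f ⟨h1, h2, h3, h4⟩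
  exact ⟨h1, h2, fun m hm _ _ => h3 m hm, h4, by simpa using h3 2 (by norm_num)⟩

end

theorem ncard_antichainPtns_eq {α β : Type*} [PartialOrder α] [Finite α] [PartialOrder β]
    [Finite β] {ω : α → ℕ} {τ : β → ℕ} (hω : NatLabeled ω) (hτ : NatLabeled τ) (h : KEq ω τ)
    (k : ℕ) (w : ℕ →₀ ℕ) (hk : w 2 = k) (hw : ∀ m, 2 < m → m < k + 3 → w m = 0) :
    (antichainPtns α w).ncard = (antichainPtns β w).ncard := by
  induction k using Nat.strong_induction_on generalizing w with
  | _ k ih =>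
    rcases Nat.eq_zero_or_pos k with rfl | hpos
    · rw [ncard_antichainPtns_of_eq_zero hω hk, ncard_antichainPtns_of_eq_zero hτ hk, h w]
    · have hq : 2 < k + 2 := by omega
      have hw' (m : ℕ) (h2 : 2 < m) (hm : m < k + 2) : w m = 0 := hw m h2 (by omega)
      have ha := sum_neg_one_pow_mul_ncard_antichainPtns (α := α) hq hpos hw'
      have hb := sum_neg_one_pow_mul_ncard_antichainPtns (α := β) hq hpos hw'
      have hlast : (w.update 2 k).update (k + 2) (k - k) = w := by
        ext m
        simp only [Finsupp.update_apply]
        split_ifs with h1 h2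
        · rw [h1, hw _ (by omega) (by omega), Nat.sub_self]
        · rw [h2, hk]
        · rfl
      rw [Finset.sum_range_succ, hlast] at ha hb
      have hsum : ∀ j ∈ Finset.range k,
          (-1 : ℤ) ^ j * (antichainPtns α ((w.update 2 j).update (k + 2) (k - j))).ncard =
          (-1 : ℤ) ^ j * (antichainPtns β ((w.update 2 j).update (k + 2) (k - j))).ncard := by
        intro j hj
        rw [Finset.mem_range] at hj
        rw [ih j hj]
        · simp only [Finsupp.update_apply]
          rw [if_neg (by omega), if_pos trivial]
        · intro m hm hmj
          simp only [Finsupp.update_apply]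
          rw [if_neg (by omega), if_neg (by omega), hw m hm (by omega)]
      rw [Finset.sum_congr rfl hsum] at ha
      have hmul := add_left_cancel (ha.trans hb.symm)
      exact_mod_cast mul_left_cancel₀ (pow_ne_zero k (by norm_num)) hmul

theorem exists_antichain_of_kEq {α β : Type*} [PartialOrder α] [Finite α] [PartialOrder β]
    [Finite β] {ω : α → ℕ} {τ : β → ℕ} (hω : NatLabeled ω) (hτ : NatLabeled τ) (h : KEq ω τ)
    {s : Set α} (hs : IsAntichain (· ≤ ·) s) :
    ∃ t : Set β, IsAntichain (· ≤ ·) t ∧ t.ncard = s.ncard := by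
  obtain ⟨w, hw2, hw, hne⟩ := exists_mem_antichainPtns hs
  have hcard := ncard_antichainPtns_eq hω hτ h _ w hw2 hw
  have hpos := (Set.ncard_pos (finite_antichainPtns w)).2 hne
  obtain ⟨g, -, -, hg, hanti⟩ := Set.nonempty_of_ncard_ne_zero (hcard ▸ hpos.ne')
  exact ⟨g ⁻¹' {2}, hanti, by rw [hg 2 (by norm_num), hw2]⟩

/-- If `(P,ω)` and `(Q,τ)` are naturally labeled posets with `(P,ω) ~ (Q,τ)`, then
`P` and `Q` have the same width. -/
theorem stmt11 {α β : Type*} [PartialOrder α] [Fintype α] [PartialOrder β] [Fintype β]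
    (ω : α → ℕ) (τ : β → ℕ) (hω : IsLabeling ω) (hτ : IsLabeling τ)
    (hnatω : NatLabeled ω) (hnatτ : NatLabeled τ) (h : KEq ω τ) :
    posetWidth α = posetWidth β := by
  unfold posetWidth
  congr 1
  ext k
  constructor
  · rintro ⟨s, hs, rfl⟩
    exact exists_antichain_of_kEq hnatω hnatτ h hs
  · rintro ⟨s, hs, rfl⟩
    exact exists_antichain_of_kEq hnatτ hnatω (fun w => (h w).symm) hs
end

section
/- Suppose labeled posets (P,ω) and (Q,τ) each have exactly one element of jump 0. Letting (P̂,ω̂) and (Q̂,τ̂) respectively denote (P,ω) and (Q,τ) with this jump-0 element removed, we have (P,ω) ~ (Q,τ) if and only if (P̂,ω̂) ~ (Q̂,τ̂). -/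
/-- `l` is a saturated chain from `b` down to a minimal element. -/
def IsSatDownChain {α : Type*} [PartialOrder α] (b : α) (l : List α) : Prop :=
  l.head? = some b ∧ List.Chain' (fun x y => y ⋖ x) l ∧
    ∃ m, l.getLast? = some m ∧ IsMin m

/-- The number of strict edges of a saturated chain `l = [c₀, …, c_k]`. -/
def strictEdgeCount {α : Type*} (ω : α → ℕ) (l : List α) : ℕ :=
  ((l.zip l.tail).filter fun p => decide (ω p.1 < ω p.2)).length

/-- The jump of `b` in `(P,ω)`: the maximum number of strict edges on a saturated chain
from `b` down to a minimal element. -/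
noncomputable def jump {α : Type*} [PartialOrder α] (ω : α → ℕ) (b : α) : ℕ :=
  sSup {k : ℕ | ∃ l : List α, IsSatDownChain b l ∧ strictEdgeCount ω l = k}

theorem jump_eq_zero_of_isMin {α : Type*} [PartialOrder α] (ω : α → ℕ) {m : α} (hm : IsMin m) :
    jump ω m = 0 := by
  have hz : ∀ k ∈ {k : ℕ | ∃ l : List α, IsSatDownChain m l ∧ strictEdgeCount ω l = k}, k = 0 := by
    rintro k ⟨l, ⟨h1, h2, -⟩, rfl⟩
    match l, h1, h2 with
    | [], h1, _ => simp at h1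
    | [x], _, _ => simp [strictEdgeCount]
    | x :: y :: l, h1, h2 =>
      obtain rfl : x = m := by simpa using h1
      exact absurd hm (List.isChain_cons_cons.1 h2).1.lt.not_isMin
  unfold jump
  rcases Set.eq_empty_or_nonempty
    {k : ℕ | ∃ l : List α, IsSatDownChain m l ∧ strictEdgeCount ω l = k} with h | h
  · rw [h]; simp
  · exact hz _ (Nat.sSup_mem h ⟨0, fun k hk => (hz k hk).le⟩)

theorem exists_satDownChain_of_jump_ne_zero {α : Type*} [PartialOrder α] {ω : α → ℕ} {b : α}
    (hb : jump ω b ≠ 0) : ∃ l, IsSatDownChain b l ∧ strictEdgeCount ω l ≠ 0 := by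
  contrapose! hb
  unfold jump
  refine Nat.le_zero.1 (csSup_le' ?_)
  rintro k ⟨l, hl, rfl⟩
  exact (hb l hl).le

theorem IsPtn.getLast_le_head {α : Type*} [PartialOrder α] {ω : α → ℕ} {m : α} :
    ∀ (l : List α) (b : α), l.head? = some b → l.IsChain (fun x y => y ⋖ x) →
      l.getLast? = some m → m ≤ b ∧ (strictEdgeCount ω l ≠ 0 → ∀ f, IsPtn ω f → f m < f b)
  | [], b, h, _, _ => by simp at h
  | [x], b, h, _, hm => by
    obtain rfl : x = b := by simpa using h
    obtain rfl : x = m := by simpa using hm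
    simp [strictEdgeCount]
  | x :: y :: l, b, h, hc, hm => by
    obtain rfl : x = b := by simpa using h
    obtain ⟨hyx, hc⟩ := List.isChain_cons_cons.1 hc
    obtain ⟨hmy, hlt⟩ := IsPtn.getLast_le_head (ω := ω) (y :: l) y rfl hc (by simpa using hm)
    refine ⟨hmy.trans hyx.le, fun hs f hf => ?_⟩
    by_cases hxy : ω x < ω y
    · exact (hf.2.1 m y hmy).trans_lt (hf.2.2 y x hyx.le hxy)
    · refine (hlt ?_ f hf).trans_le (hf.2.1 y x hyx.le)
      simpa [strictEdgeCount, hxy] using hs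

/-- The unique element of jump `0` is the bottom element, and every `(P,ω)`-partition takes a
strictly smaller value there than anywhere else. -/
theorem le_and_lt_of_unique_jump_zero {α : Type*} [PartialOrder α] {ω : α → ℕ} {p : α}
    (hp : ∀ a, jump ω a = 0 → a = p) {b : α} (hb : jump ω b ≠ 0) :
    p ≤ b ∧ ∀ f, IsPtn ω f → f p < f b := by
  obtain ⟨l, ⟨h1, h2, m, h3, hm⟩, hs⟩ := exists_satDownChain_of_jump_ne_zero hb
  obtain rfl := hp m (jump_eq_zero_of_isMin ω hm)
  exact (IsPtn.getLast_le_head l b h1 h2 h3).imp_right fun h => h hs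

theorem weight_ne_zero {α : Type*} [Finite α] {f : α → ℕ} {n m : ℕ} (a : α)
    (h : (f ⁻¹' {m}).ncard = n) (ha : f a = m) : n ≠ 0 := by
  rw [← h]
  exact Set.ncard_ne_zero_of_mem (a := a) ha

theorem exists_of_weight_ne_zero {α : Type*} {f : α → ℕ} {n m : ℕ}
    (h : (f ⁻¹' {m}).ncard = n) (hn : n ≠ 0) : ∃ a, f a = m :=
  Set.nonempty_of_ncard_ne_zero (h.trans_ne hn)

theorem ncard_preimage_subtype {α : Type*} {q : α → Prop} {p : α} (hq : ∀ a, q a ↔ a ≠ p)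
    {f : α → ℕ} {m : ℕ} (hm : m ≠ f p) :
    ((fun x : {a // q a} => f x.1) ⁻¹' {m}).ncard = (f ⁻¹' {m}).ncard := by
  rw [← Set.ncard_image_of_injective _ Subtype.val_injective]
  congr 1
  ext a
  simp only [Set.mem_image, Set.mem_preimage, Set.mem_singleton_iff, Subtype.exists,
    exists_and_left, exists_prop, exists_eq_right_right, hq]
  refine ⟨fun h => h.1, fun h => ⟨h, ?_⟩⟩
  rintro rfl
  exact hm h.symm

theorem preimage_singleton_bot {α : Type*} {p : α} {f : α → ℕ}
    (hlt : ∀ b, b ≠ p → f p < f b) : f ⁻¹' {f p} = {p} := by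
  ext a
  simp only [Set.mem_preimage, Set.mem_singleton_iff]
  refine ⟨fun h => ?_, fun h => h ▸ rfl⟩
  by_contra hne
  exact (hlt a hne).ne' h

theorem ptnCount_eq_erase {α : Type*} [PartialOrder α] [Finite α] {ω : α → ℕ} {q : α → Prop}
    {p : α} (hq : ∀ a, q a ↔ a ≠ p) (hle : ∀ b, p ≤ b)
    (hlt : ∀ f, IsPtn ω f → ∀ b, b ≠ p → f p < f b) {ω' : {a // q a} → ℕ}
    (hcomp : ∀ a b, ω' a < ω' b ↔ ω a.1 < ω b.1) {w : ℕ →₀ ℕ} {i : ℕ} (hi : 1 ≤ i)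
    (hwi : w i = 1) (hw : ∀ j, 1 ≤ j → j < i → w j = 0) :
    ptnCount ω w = ptnCount ω' (w.erase i) := by
  classical
  have hpi : ∀ f, IsPtn ω f → (∀ m : ℕ, 1 ≤ m → (f ⁻¹' {m}).ncard = w m) → f p = i := by
    intro f hf hfw
    obtain ⟨a, ha⟩ := exists_of_weight_ne_zero (hfw i hi) (by omega)
    have h1 := hf.2.1 p a (hle a)
    have h2 := weight_ne_zero p (hfw (f p) (hf.1 p)) rfl
    by_contra hne
    exact h2 (hw _ (hf.1 p) (by omega))
  refine Set.BijOn.ncard_eq (f := fun f x => f x.1) ⟨?_, ?_, ?_⟩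
  · rintro f ⟨hf, hfw⟩
    have hfp := hpi f hf hfw
    refine ⟨⟨fun a => hf.1 a, fun a b h => hf.2.1 a b h,
      fun a b h h' => hf.2.2 a b h ((hcomp b a).1 h')⟩, fun m hm => ?_⟩
    by_cases hmi : m = i
    · subst hmi
      rw [Finsupp.erase_same, Set.ncard_eq_zero, Set.eq_empty_iff_forall_notMem]
      intro x hx
      exact (hlt f hf x ((hq _).1 x.2)).ne' (Eq.trans hx hfp.symm)
    · rw [Finsupp.erase_ne hmi, ← hfw m hm]
      exact ncard_preimage_subtype hq (by omega)
  · rintro f ⟨hf, hfw⟩ g ⟨hg, hgw⟩ hfg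
    funext a
    by_cases ha : a = p
    · rw [ha, hpi f hf hfw, hpi g hg hgw]
    · exact congrFun hfg ⟨a, (hq a).2 ha⟩
  · rintro g ⟨hg, hgw⟩
    have hgi : ∀ x, i < g x := by
      intro x
      have h := weight_ne_zero x (hgw (g x) (hg.1 x)) rfl
      have hne : g x ≠ i := by
        intro hne
        rw [hne, Finsupp.erase_same] at h
        exact h rfl
      rw [Finsupp.erase_ne hne] at h
      by_contra hlt'
      exact h (hw _ (hg.1 x) (by omega))
    let f : α → ℕ := fun a => if h : q a then g ⟨a, h⟩ else i
    have hfq : ∀ x : {a // q a}, f x.1 = g x := fun x => dif_pos x.2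
    have hfp : f p = i := dif_neg fun h => (hq p).1 h rfl
    have hlt' : ∀ b, b ≠ p → f p < f b := fun b hb => by
      rw [hfp, hfq ⟨b, (hq b).2 hb⟩]
      exact hgi _
    have hbot : ∀ a, a ≤ p → a = p := fun a ha => le_antisymm ha (hle a)
    refine ⟨f, ⟨⟨fun a => ?_, fun a b hab => ?_, fun a b hab hω => ?_⟩, fun m hm => ?_⟩,
      funext hfq⟩
    · by_cases ha : a = p
      · rw [ha, hfp]; exact hi
      · rw [hfq ⟨a, (hq a).2 ha⟩]; exact hg.1 _
    · by_cases hb : b = p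
      · subst hb; rw [hbot a hab]
      · by_cases ha : a = p
        · subst ha; exact (hlt' b hb).le
        · rw [hfq ⟨a, (hq a).2 ha⟩, hfq ⟨b, (hq b).2 hb⟩]; exact hg.2.1 _ _ hab
    · by_cases hb : b = p
      · subst hb; rw [hbot a hab] at hω; exact absurd hω (lt_irrefl _)
      · by_cases ha : a = p
        · subst ha; exact hlt' b hb
        · rw [hfq ⟨a, (hq a).2 ha⟩, hfq ⟨b, (hq b).2 hb⟩]
          exact hg.2.2 _ _ hab ((hcomp _ _).2 hω)
    · by_cases hmi : m = i
      · rw [hmi, hwi, ← hfp, preimage_singleton_bot hlt', Set.ncard_singleton]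
      · rw [← Finsupp.erase_ne (f := w) hmi, ← hgw m hm, ← ncard_preimage_subtype hq (by omega)]
        simp only [hfq]

theorem exists_of_ptnCount_ne_zero {α : Type*} [PartialOrder α] {ω : α → ℕ}
    {p : α} (hle : ∀ b, p ≤ b) (hlt : ∀ f, IsPtn ω f → ∀ b, b ≠ p → f p < f b)
    {w : ℕ →₀ ℕ} (h : ptnCount ω w ≠ 0) :
    ∃ i, 1 ≤ i ∧ w i = 1 ∧ ∀ j, 1 ≤ j → j < i → w j = 0 := by
  obtain ⟨f, hf, hfw⟩ := Set.nonempty_of_ncard_ne_zero h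
  refine ⟨f p, hf.1 p, ?_, fun j hj hji => ?_⟩
  · rw [← hfw _ (hf.1 p), preimage_singleton_bot (hlt f hf), Set.ncard_singleton]
  · by_contra hne
    obtain ⟨a, ha⟩ := exists_of_weight_ne_zero (hfw j hj) hne
    have := hf.2.1 p a (hle a)
    omega

/-- Adding `1` to all values does not change the number of partitions. -/
theorem ptnCount_shift {α : Type*} [PartialOrder α] [Finite α] (ω : α → ℕ) {w v : ℕ →₀ ℕ}
    (hv : v 1 = 0) (hvw : ∀ m, 1 ≤ m → v (m + 1) = w m) : ptnCount ω w = ptnCount ω v := by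
  refine Set.BijOn.ncard_eq (f := fun f a => f a + 1) ⟨?_, ?_, ?_⟩
  · rintro f ⟨hf, hfw⟩
    refine ⟨⟨fun a => by simp, fun a b h => Nat.succ_le_succ (hf.2.1 a b h),
      fun a b h h' => Nat.succ_lt_succ (hf.2.2 a b h h')⟩, fun m hm => ?_⟩
    obtain ⟨m, rfl⟩ := Nat.exists_eq_add_of_le' hm
    rcases Nat.eq_zero_or_pos m with rfl | hm'
    · rw [hv, Set.ncard_eq_zero, Set.eq_empty_iff_forall_notMem]
      intro a ha
      have h1 := hf.1 a
      have h2 : f a + 1 = 0 + 1 := ha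
      omega
    · rw [hvw m hm', ← hfw m hm']
      congr 1
      ext a
      simp
  · intro f _ g _ hfg
    funext a
    exact Nat.succ_injective (congrFun hfg a)
  · rintro g ⟨hg, hgw⟩
    have h2 : ∀ a, 2 ≤ g a := by
      intro a
      have h1 := hg.1 a
      by_contra hlt
      exact weight_ne_zero a (hgw 1 le_rfl) (by omega) hv
    refine ⟨fun a => g a - 1, ⟨⟨fun a => ?_, fun a b h => ?_, fun a b h h' => ?_⟩,
      fun m hm => ?_⟩, ?_⟩
    · have := h2 a; dsimp only; omega
    · have := hg.2.1 a b h; dsimp only; omega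
    · have := hg.2.2 a b h h'; have := h2 a; dsimp only; omega
    · rw [← hvw m hm, ← hgw (m + 1) (by omega)]
      congr 1
      ext a
      have := h2 a
      simp only [Set.mem_preimage, Set.mem_singleton_iff]
      omega
    · funext a
      have := h2 a
      dsimp only
      omega


/-- Suppose `(P,ω)` and `(Q,τ)` each have exactly one element of jump 0.  With
`(P̂,ω̂)` and `(Q̂,τ̂)` the labeled posets obtained by removing this jump-0 element (with the
induced orders, relabeled by the unique bijections onto `{1,…,|P̂|}` and `{1,…,|Q̂|}` ordered
consistently with `ω` and `τ`), we have `(P,ω) ~ (Q,τ)` if and only if `(P̂,ω̂) ~ (Q̂,τ̂)`. -/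
theorem stmt13 {α β : Type*} [PartialOrder α] [Fintype α] [PartialOrder β] [Fintype β]
    (ω : α → ℕ) (τ : β → ℕ) (hω : IsLabeling ω) (hτ : IsLabeling τ)
    (huniqP : ∃! a : α, jump ω a = 0) (huniqQ : ∃! b : β, jump τ b = 0)
    (ω' : {a : α // jump ω a ≠ 0} → ℕ) (τ' : {b : β // jump τ b ≠ 0} → ℕ)
    (hω' : IsLabeling ω') (hτ' : IsLabeling τ')
    (hω'comp : ∀ a b : {a : α // jump ω a ≠ 0}, ω' a < ω' b ↔ ω a.1 < ω b.1)
    (hτ'comp : ∀ a b : {b : β // jump τ b ≠ 0}, τ' a < τ' b ↔ τ a.1 < τ b.1) :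
    KEq ω τ ↔ KEq ω' τ' := by
  obtain ⟨p, hp, hpu⟩ := huniqP
  obtain ⟨r, hr, hru⟩ := huniqQ
  have hqP : ∀ a, jump ω a ≠ 0 ↔ a ≠ p := fun a =>
    not_congr ⟨fun h => hpu a h, fun h => h ▸ hp⟩
  have hqQ : ∀ b, jump τ b ≠ 0 ↔ b ≠ r := fun b =>
    not_congr ⟨fun h => hru b h, fun h => h ▸ hr⟩
  have hleP : ∀ b, p ≤ b := fun b => by
    by_cases hb : b = p
    · exact hb.ge
    · exact (le_and_lt_of_unique_jump_zero hpu ((hqP b).2 hb)).1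
  have hleQ : ∀ b, r ≤ b := fun b => by
    by_cases hb : b = r
    · exact hb.ge
    · exact (le_and_lt_of_unique_jump_zero hru ((hqQ b).2 hb)).1
  have hltP : ∀ f, IsPtn ω f → ∀ b, b ≠ p → f p < f b := fun f hf b hb =>
    (le_and_lt_of_unique_jump_zero hpu ((hqP b).2 hb)).2 f hf
  have hltQ : ∀ f, IsPtn τ f → ∀ b, b ≠ r → f r < f b := fun f hf b hb =>
    (le_and_lt_of_unique_jump_zero hru ((hqQ b).2 hb)).2 f hf
  constructor
  · intro h w
    let s : ℕ →₀ ℕ := w.embDomain (addRightEmbedding 1)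
    have hs : ∀ m, s (m + 1) = w m := fun m => Finsupp.embDomain_apply_self _ _ m
    let v : ℕ →₀ ℕ := s.erase 1
    have hv : v 1 = 0 := Finsupp.erase_same
    have hvw : ∀ m, 1 ≤ m → v (m + 1) = w m := fun m hm => by
      rw [Finsupp.erase_ne (by omega), hs]
    have hu : (s.update 1 1).erase 1 = v := by
      ext m
      by_cases hm : m = 1
      · simp [v, hm]
      · simp [v, hm, Finsupp.erase_ne]
    have hu1 : (s.update 1 1) 1 = 1 := by simp
    rw [ptnCount_shift ω' hv hvw, ptnCount_shift τ' hv hvw, ← hu,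
      ← ptnCount_eq_erase hqP hleP hltP hω'comp le_rfl hu1 (by omega),
      ← ptnCount_eq_erase hqQ hleQ hltQ hτ'comp le_rfl hu1 (by omega)]
    exact h _
  · intro h w
    by_cases hw : ∃ i, 1 ≤ i ∧ w i = 1 ∧ ∀ j, 1 ≤ j → j < i → w j = 0
    · obtain ⟨i, hi, hwi, hwj⟩ := hw
      rw [ptnCount_eq_erase hqP hleP hltP hω'comp hi hwi hwj,
        ptnCount_eq_erase hqQ hleQ hltQ hτ'comp hi hwi hwj]
      exact h _
    · have h1 := mt (exists_of_ptnCount_ne_zero hleP hltP) hw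
      have h2 := mt (exists_of_ptnCount_ne_zero hleQ hltQ) hw
      rw [not_ne_iff.1 h1, not_ne_iff.1 h2]
end
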